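/- (Decomposition of the correlation determinant for a stationary AR(p)-structured covariance) Let 1 ≤ p ≤ T, let σ_z > 0 and σ_ε > 0, and let Σ be a real symmetric positive definite T×T matrix such that Σ_{tt} = σ_z² for all 0 ≤ t ≤ T−1 and s_t(Σ) = σ_ε² for all p ≤ t ≤ T−1. Then det R(Σ) = det R(Σ^{(p)}) · (σ_ε²/σ_z²)^{T−p}. -/

import Mathlib

open Matrix

/-- The correlation matrix: `R(Σ)_{ij} = Σ_{ij} / √(Σ_{ii} Σ_{jj})`. -/
noncomputable def corrMat {T : ℕ} (S : Matrix (Fin T) (Fin T) ℝ) :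
    Matrix (Fin T) (Fin T) ℝ :=
  fun i j => S i j / Real.sqrt (S i i * S j j)

/-- The `k×k` leading principal submatrix of a `T×T` matrix (0-based indices). -/
def lead {T : ℕ} (S : Matrix (Fin T) (Fin T) ℝ) (k : ℕ) (hk : k ≤ T) :
    Matrix (Fin k) (Fin k) ℝ :=
  S.submatrix (Fin.castLE hk) (Fin.castLE hk)

/-- The innovation variances: `s_0(Σ) = Σ_{00}` and, for `t ≥ 1`,
`s_t(Σ) = Σ_{tt} − b_tᵀ (Σ^{(t)})⁻¹ b_t` with `b_t = (Σ_{it})_{i<t}`. -/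
noncomputable def innov {T : ℕ} (S : Matrix (Fin T) (Fin T) ℝ) (t : Fin T) : ℝ :=
  S t t -
    (fun i : Fin t.val => S (Fin.castLE t.isLt.le i) t) ⬝ᵥ
      ((lead S t.val t.isLt.le)⁻¹ *ᵥ fun i : Fin t.val => S (Fin.castLE t.isLt.le i) t)


theorem lead_posDef {T : ℕ} (S : Matrix (Fin T) (Fin T) ℝ) (hS : S.PosDef) (k : ℕ) (hk : k ≤ T) :
    (lead S k hk).PosDef :=
  hS.submatrix (Fin.castLE_injective hk)

theorem det_lead_succ {T : ℕ} (S : Matrix (Fin T) (Fin T) ℝ) (hS : S.PosDef) (k : ℕ)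
    (hk : k < T) :
    (lead S (k+1) hk).det = (lead S k hk.le).det * innov S ⟨k, hk⟩ := by
  have hu : IsUnit (lead S k hk.le) := (lead_posDef S hS k hk.le).isUnit
  letI := hu.invertible
  have hsym : ∀ i j, S i j = S j i := fun i j => by
    have := hS.isHermitian.apply j i
    simpa using this
  let B : Matrix (Fin k) (Fin 1) ℝ := fun i _ => S (Fin.castLE hk.le i) ⟨k, hk⟩
  let D : Matrix (Fin 1) (Fin 1) ℝ := fun _ _ => S ⟨k, hk⟩ ⟨k, hk⟩
  have h1 : (lead S (k+1) hk).submatrix finSumFinEquiv finSumFinEquiv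
      = Matrix.fromBlocks (lead S k hk.le) B Bᵀ D := by
    have hl : ∀ j : Fin 1, Fin.castLE hk (Fin.natAdd k j) = ⟨k, hk⟩ := by
      intro j; ext; simp
    ext i j
    rcases i with i | i <;> rcases j with j | j
    · rfl
    · simp only [lead, submatrix_apply, finSumFinEquiv_apply_right, fromBlocks_apply₁₂, B, hl]
      rfl
    · simp only [lead, submatrix_apply, finSumFinEquiv_apply_right, fromBlocks_apply₂₁, B, hl,
        transpose_apply]
      exact hsym _ _
    · simp only [lead, submatrix_apply, finSumFinEquiv_apply_right, fromBlocks_apply₂₂, D, hl]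
      rfl
  rw [← Matrix.det_submatrix_equiv_self finSumFinEquiv, h1, Matrix.det_fromBlocks₁₁]
  congr 1
  rw [Matrix.det_fin_one, Matrix.mul_assoc, invOf_eq_nonsing_inv]
  rfl

theorem det_corrMat_const {n : ℕ} (S : Matrix (Fin n) (Fin n) ℝ) (c : ℝ) (hc : 0 < c)
    (h : ∀ t, S t t = c) : (corrMat S).det = S.det / c ^ n := by
  have : corrMat S = c⁻¹ • S := by
    ext i j
    simp only [corrMat, h, Matrix.smul_apply, smul_eq_mul, Real.sqrt_mul_self hc.le]
    ring
  rw [this, Matrix.det_smul, Fintype.card_fin, inv_pow]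
  ring

theorem det_corr_decomp_AR {T p : ℕ} (hp : 1 ≤ p) (hpT : p ≤ T)
    (σz σε : ℝ) (hz : 0 < σz) (hε : 0 < σε)
    (S : Matrix (Fin T) (Fin T) ℝ) (hS : S.PosDef)
    (hdiag : ∀ t : Fin T, S t t = σz ^ 2)
    (hinn : ∀ t : Fin T, p ≤ t.val → innov S t = σε ^ 2) :
    (corrMat S).det = (corrMat (lead S p hpT)).det * (σε ^ 2 / σz ^ 2) ^ (T - p) := by
  have key : ∀ m (hm : p + m ≤ T),
      (lead S (p + m) hm).det = (lead S p hpT).det * (σε ^ 2) ^ m := by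
    intro m
    induction m with
    | zero => intro hm; simp
    | succ m ih =>
      intro hm
      have := det_lead_succ S hS (p + m) hm
      rw [hinn _ (Nat.le_add_right p m), ih (by omega)] at this
      rw [pow_succ, ← mul_assoc]
      exact this
  obtain ⟨m, rfl⟩ := Nat.exists_eq_add_of_le hpT
  have hk := key m le_rfl
  have hl : lead S (p + m) le_rfl = S := rfl
  have hc : 0 < σz ^ 2 := by positivity
  rw [hl] at hk
  rw [det_corrMat_const S _ hc hdiag,
    det_corrMat_const (lead S p hpT) _ hc (fun t => hdiag _), hk, Nat.add_sub_cancel_left,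
    div_pow, pow_add]
  field_simp
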